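/- arXiv:2603.24495 — 2 statements merged into one kernel-verified Lean document; each statement's English description precedes it below -/
import Mathlib

section
/- For the transition kernel q_t of reflected Brownian motion on [0,1]^D and any x ∈ [0,1]^D, t > 0, ∫_{[0,1]^D} |∇_y q_t(x, y)| dy ≤ √D/√t. Consequently ∫_{[0,1]^D} |∇_y log q_t(x,y)| q_t(x,y) dy ≤ √D/√t. -/
open MeasureTheory Real

/-- Reflected heat kernel on `[0,1]^D`:
`q_t(a,b) = (2πt)^{-D/2} ∑_{z ∈ ℤ^D} exp(-|R_z(b)+z-a|²/(2t))`. -/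
noncomputable def qkerE (D : ℕ) (t : ℝ) (a b : EuclideanSpace ℝ (Fin D)) : ℝ :=
  (2 * π * t) ^ (-(D : ℝ) / 2) *
    ∑' z : Fin D → ℤ,
      Real.exp (-(∑ i, ((if Even (z i) then b i else 1 - b i) + (z i : ℝ) - a i) ^ 2) / (2 * t))


section Gaussian

variable {E : Type*} [NormedAddCommGroup E] [InnerProductSpace ℝ E] [FiniteDimensional ℝ E]
  [Nontrivial E] [MeasurableSpace E] [BorelSpace E]

lemma rpow_natCast_sub_one_mul_eqOn (n : ℕ) (hn : 0 < n) (k : ℕ) (b : ℝ) :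
    Set.EqOn (fun r : ℝ => r ^ (n - 1) • (r ^ k * exp (-b * r ^ 2)))
      (fun r => r ^ ((n : ℝ) - 1 + k) * exp (-b * r ^ (2 : ℝ))) (Set.Ioi 0) := by
  intro r hr
  have hr : 0 < r := hr
  have h : ((n - 1 : ℕ) : ℝ) = (n : ℝ) - 1 := by
    rw [Nat.cast_sub hn, Nat.cast_one]
  simp only [smul_eq_mul]
  rw [← h, rpow_add hr, rpow_natCast, rpow_natCast, rpow_two, mul_assoc]

/-- Radial Gaussian moments are integrable. -/
lemma integrable_norm_pow_mul_exp_neg_mul_norm_sq (k : ℕ) {b : ℝ} (hb : 0 < b) :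
    Integrable fun v : E => ‖v‖ ^ k * exp (-b * ‖v‖ ^ 2) := by
  have hn : 0 < Module.finrank ℝ E := Module.finrank_pos
  have hn' : (0 : ℝ) < Module.finrank ℝ E := by exact_mod_cast hn
  rw [integrable_fun_norm_addHaar volume (f := fun r : ℝ => r ^ k * exp (-b * r ^ 2)),
    integrableOn_congr_fun (rpow_natCast_sub_one_mul_eqOn _ hn k b) measurableSet_Ioi]
  exact integrableOn_rpow_mul_exp_neg_mul_rpow
    (by have := k.cast_nonneg (α := ℝ); linarith) two_pos hb

/-- The second moment of a Gaussian on a Euclidean space, in terms of its total mass. -/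
lemma integral_norm_sq_mul_exp_neg_mul_norm_sq {b : ℝ} (hb : 0 < b) :
    ∫ v : E, ‖v‖ ^ 2 * exp (-b * ‖v‖ ^ 2) =
      Module.finrank ℝ E / (2 * b) * ∫ v : E, exp (-b * ‖v‖ ^ 2) := by
  have hn : 0 < Module.finrank ℝ E := Module.finrank_pos
  have hn' : (0 : ℝ) < Module.finrank ℝ E := by exact_mod_cast hn
  have moment (k : ℕ) : ∫ r in Set.Ioi (0 : ℝ),
      r ^ (Module.finrank ℝ E - 1) • (r ^ k * exp (-b * r ^ 2)) =
      b ^ (-((Module.finrank ℝ E : ℝ) - 1 + k + 1) / 2) * (1 / 2) *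
        Gamma (((Module.finrank ℝ E : ℝ) - 1 + k + 1) / 2) := by
    rw [setIntegral_congr_fun measurableSet_Ioi (rpow_natCast_sub_one_mul_eqOn _ hn k b)]
    exact integral_rpow_mul_exp_neg_mul_rpow two_pos
      (by have := k.cast_nonneg (α := ℝ); linarith) hb
  have h2 := integral_fun_norm_addHaar (E := E) volume fun r : ℝ => r ^ 2 * exp (-b * r ^ 2)
  have h0 := integral_fun_norm_addHaar (E := E) volume fun r : ℝ => r ^ 0 * exp (-b * r ^ 2)
  rw [moment] at h2 h0
  simp only [pow_zero, one_mul] at h0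
  rw [h2, h0]
  have hG : Gamma (((Module.finrank ℝ E : ℝ) - 1 + (2 : ℕ) + 1) / 2) =
      Module.finrank ℝ E / 2 * Gamma (((Module.finrank ℝ E : ℝ) - 1 + (0 : ℕ) + 1) / 2) := by
    rw [show ((Module.finrank ℝ E : ℝ) - 1 + (2 : ℕ) + 1) / 2 = Module.finrank ℝ E / 2 + 1 by
      push_cast; ring, Gamma_add_one (by positivity)]
    congr 2
    push_cast; ring
  have hp : b ^ (-((Module.finrank ℝ E : ℝ) - 1 + (2 : ℕ) + 1) / 2) =
      b ^ (-((Module.finrank ℝ E : ℝ) - 1 + (0 : ℕ) + 1) / 2) / b := by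
    rw [← rpow_sub_one hb.ne']
    congr 1
    push_cast; ring
  rw [hG, hp]
  simp only [nsmul_eq_mul, smul_eq_mul]
  field_simp

/-- The expected norm of a centred Gaussian vector of covariance `t • 1`, divided by `t`. -/
lemma lintegral_norm_div_mul_gaussian_le {t : ℝ} (ht : 0 < t) :
    ∫⁻ v : E, ENNReal.ofReal ((2 * π * t) ^ (-(Module.finrank ℝ E : ℝ) / 2) *
        (‖v‖ / t * exp (-‖v‖ ^ 2 / (2 * t)))) ≤
      ENNReal.ofReal (√(Module.finrank ℝ E) / √t) := by
  set n := Module.finrank ℝ E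
  have hn : 0 < (n : ℝ) := by exact_mod_cast (Module.finrank_pos : 0 < Module.finrank ℝ E)
  have hsn : 0 < √(n : ℝ) := sqrt_pos.2 hn
  have hst : 0 < √t := sqrt_pos.2 ht
  have hb : 0 < 1 / (2 * t) := by positivity
  set C : ℝ := (2 * π * t) ^ (-(n : ℝ) / 2)
  have hC : 0 < C := by positivity
  have h0 : Integrable fun v : E => exp (-(1 / (2 * t)) * ‖v‖ ^ 2) := by
    simpa using integrable_norm_pow_mul_exp_neg_mul_norm_sq (E := E) 0 hb
  have h2 := integrable_norm_pow_mul_exp_neg_mul_norm_sq (E := E) 2 hb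
  have hmass : C * ∫ v : E, exp (-(1 / (2 * t)) * ‖v‖ ^ 2) = 1 := by
    rw [GaussianFourier.integral_rexp_neg_mul_sq_norm hb,
      show π / (1 / (2 * t)) = 2 * π * t by field_simp, ← rpow_add (by positivity)]
    simp [n, neg_div]
  set H : E → ℝ := fun v => C * (√n / √t / 2 * exp (-(1 / (2 * t)) * ‖v‖ ^ 2) +
    1 / (2 * t * √t * √n) * (‖v‖ ^ 2 * exp (-(1 / (2 * t)) * ‖v‖ ^ 2))) with hH
  have hHint : Integrable H := ((h0.const_mul _).add (h2.const_mul _)).const_mul _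
  have hHval : ∫ v, H v = √n / √t := by
    rw [hH, integral_const_mul, integral_add (h0.const_mul _) (h2.const_mul _),
      integral_const_mul, integral_const_mul, integral_norm_sq_mul_exp_neg_mul_norm_sq hb]
    calc _ = (√n / √t / 2 + 1 / (2 * t * √t * √n) * (n / (2 * (1 / (2 * t))))) *
          (C * ∫ v : E, exp (-(1 / (2 * t)) * ‖v‖ ^ 2)) := by ring
      _ = √n / √t := by
        rw [hmass]
        field_simp
        rw [sq_sqrt hn.le]
        ring
  rw [← hHval, ofReal_integral_eq_lintegral_ofReal hHint (.of_forall fun v => by positivity)]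
  gcongr with v
  simp only [hH]
  have hexp : -‖v‖ ^ 2 / (2 * t) = -(1 / (2 * t)) * ‖v‖ ^ 2 := by ring
  rw [hexp, ← mul_assoc (1 / (2 * t * √t * √n)), ← add_mul]
  gcongr
  have ht2 : √t ^ 2 = t := sq_sqrt ht.le
  have hkey : √n / √t / 2 + 1 / (2 * t * √t * √n) * ‖v‖ ^ 2 - ‖v‖ / t =
      (√n * √t - ‖v‖) ^ 2 / (2 * t * √t * √n) := by
    field_simp
    linear_combination (√n ^ 2) * (-ht2)
  have : 0 ≤ (√n * √t - ‖v‖) ^ 2 / (2 * t * √t * √n) := by positivity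
  linarith

end Gaussian

section Summability

lemma summable_prod_apply_of_nonneg {ι : Type*} {f : ι → ℝ} (hf : Summable f) (h0 : 0 ≤ f) :
    ∀ n : ℕ, Summable fun z : Fin n → ι => ∏ i, f (z i)
  | 0 => Summable.of_finite
  | n + 1 => by
    rw [← (Fin.consEquiv fun _ : Fin (n + 1) => ι).summable_iff]
    have := hf.mul_of_nonneg (summable_prod_apply_of_nonneg hf h0 n) h0
      fun z => Finset.prod_nonneg fun i _ => h0 _
    refine this.congr fun p => ?_
    simp [Fin.consEquiv, Fin.prod_univ_succ]

lemma summable_exp_neg_mul_int_sq {a : ℝ} (ha : 0 < a) :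
    Summable fun k : ℤ => exp (-a * (k : ℝ) ^ 2) := by
  have h : Summable fun k : ℕ => exp (-a * (k : ℝ) ^ 2) := by
    refine Summable.of_nonneg_of_le (fun _ => (exp_pos _).le) (fun k => ?_)
      (Real.summable_exp_nat_mul_iff.2 (neg_lt_zero.2 ha))
    have hk : (k : ℝ) ≤ (k : ℝ) ^ 2 := by exact_mod_cast Nat.le_self_pow two_ne_zero k
    rw [exp_le_exp]
    nlinarith
  exact .of_nat_of_neg (by simpa using h) (by simpa using h)

end Summability

section Unfolding

variable {D : ℕ}

/-- The map `y ↦ R_z(y) + z` as an affine isometry: reflect the coordinates in which `z` is odd,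
then translate, which maps the unit cube onto its translate by `z`. -/
noncomputable def cubeUnfold (z : Fin D → ℤ) :
    EuclideanSpace ℝ (Fin D) ≃ᵃⁱ[ℝ] EuclideanSpace ℝ (Fin D) :=
  (LinearIsometryEquiv.piLpCongrRight 2 fun i =>
      if Even (z i) then LinearIsometryEquiv.refl ℝ ℝ else LinearIsometryEquiv.neg ℝ
    ).toAffineIsometryEquiv.trans
  (AffineIsometryEquiv.vaddConst ℝ
    (WithLp.toLp 2 fun i => (if Even (z i) then (0 : ℝ) else 1) + (z i : ℝ)))

lemma cubeUnfold_apply (z : Fin D → ℤ) (y : EuclideanSpace ℝ (Fin D)) (i : Fin D) :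
    cubeUnfold z y i = (if Even (z i) then y i else 1 - y i) + (z i : ℝ) := by
  by_cases h : Even (z i)
  · simp [cubeUnfold, h]
  · simp [cubeUnfold, h]
    ring

lemma measurePreserving_cubeUnfold (z : Fin D → ℤ) :
    MeasurePreserving (cubeUnfold z) volume volume :=
  (measurePreserving_add_right volume _).comp (LinearIsometryEquiv.measurePreserving _)

lemma openCube_ae_eq_cube :
    {y : EuclideanSpace ℝ (Fin D) | ∀ i, y i ∈ Set.Ioo (0 : ℝ) 1} =ᵐ[volume]
      {y : EuclideanSpace ℝ (Fin D) | ∀ i, y i ∈ Set.Icc (0 : ℝ) 1} := by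
  have h := (PiLp.volume_preserving_ofLp (Fin D)).quasiMeasurePreserving.preimage_ae_eq
    (Measure.univ_pi_Ioo_ae_eq_Icc (μ := fun _ : Fin D => (volume : Measure ℝ))
      (f := fun _ => 0) (g := fun _ => 1))
  have hopen : {y : EuclideanSpace ℝ (Fin D) | ∀ i, y i ∈ Set.Ioo (0 : ℝ) 1} =
      WithLp.ofLp ⁻¹' Set.univ.pi fun _ => Set.Ioo (0 : ℝ) 1 := by
    ext y; simp
  have hclosed : {y : EuclideanSpace ℝ (Fin D) | ∀ i, y i ∈ Set.Icc (0 : ℝ) 1} =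
      WithLp.ofLp ⁻¹' Set.Icc (fun _ => (0 : ℝ)) fun _ => 1 := by
    ext y; simp [Pi.le_def, forall_and]
  rwa [hopen, hclosed]

/-- The images of the unit cube under the maps `cubeUnfold z` tile the space. -/
lemma tsum_setLIntegral_comp_cubeUnfold_le (G : EuclideanSpace ℝ (Fin D) → ENNReal) :
    ∑' z : Fin D → ℤ, ∫⁻ y in {y : EuclideanSpace ℝ (Fin D) | ∀ i, y i ∈ Set.Icc (0 : ℝ) 1},
      G (cubeUnfold z y) ≤ ∫⁻ y, G y := by
  set S : (Fin D → ℤ) → Set (EuclideanSpace ℝ (Fin D)) :=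
    fun z => {u | ∀ i, u i ∈ Set.Ioo (z i : ℝ) (z i + 1)} with hS
  have hpre (z : Fin D → ℤ) : {y : EuclideanSpace ℝ (Fin D) | ∀ i, y i ∈ Set.Ioo (0 : ℝ) 1} =
      cubeUnfold z ⁻¹' S z := by
    ext y
    simp only [hS, Set.mem_ofPred_eq, Set.mem_preimage, cubeUnfold_apply, Set.mem_Ioo]
    refine forall_congr' fun i => ?_
    split_ifs <;> constructor <;> rintro ⟨h1, h2⟩ <;> constructor <;> linarith
  have hmeas (z : Fin D → ℤ) : MeasurableSet (S z) := by
    simp only [hS, Set.ofPred_forall]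
    exact MeasurableSet.iInter fun i =>
      measurableSet_Ioo.preimage (by fun_prop : Measurable fun u : EuclideanSpace ℝ (Fin D) => u i)
  have hdisj : Pairwise (Function.onFun Disjoint S) := by
    intro z w hzw
    refine Set.disjoint_left.2 fun u hz hw => hzw (funext fun i => ?_)
    rw [← Int.floor_eq_iff.2 ⟨(hz i).1.le, (hz i).2⟩, ← Int.floor_eq_iff.2 ⟨(hw i).1.le, (hw i).2⟩]
  calc _ = ∑' z, ∫⁻ u in S z, G u := by
        refine tsum_congr fun z => ?_
        rw [← setLIntegral_congr openCube_ae_eq_cube, hpre z]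
        exact (measurePreserving_cubeUnfold z).setLIntegral_comp_preimage_emb
          (cubeUnfold z).toHomeomorph.measurableEmbedding G (S z)
    _ = ∫⁻ u in ⋃ z, S z, G u := (lintegral_iUnion hmeas hdisj G).symm
    _ ≤ ∫⁻ u, G u := setLIntegral_le_lintegral _ _

end Unfolding

section Kernel

variable {E : Type*} [NormedAddCommGroup E] [InnerProductSpace ℝ E]

/-- A Gaussian precomposed with an affine isometry is differentiable, with the expected bound
on its derivative. -/
lemma exists_hasFDerivAt_gaussian_comp (T : E ≃ᵃⁱ[ℝ] E) (x y : E) {t : ℝ} (ht : 0 < t) :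
    ∃ f' : E →L[ℝ] ℝ, HasFDerivAt (fun y => exp (-‖T y - x‖ ^ 2 / (2 * t))) f' y ∧
      ‖f'‖ ≤ ‖T y - x‖ / t * exp (-‖T y - x‖ ^ 2 / (2 * t)) := by
  set L : E →L[ℝ] E := T.linearIsometryEquiv.toLinearIsometry.toContinuousLinearMap
  have hT : HasFDerivAt (fun y => T y - x) L y := by
    have h : (fun y => T y - x) = fun y => L y + (T 0 - x) := by
      ext y
      have := T.map_vadd 0 y
      simp only [vadd_eq_add, add_zero] at this
      rw [this, add_sub_assoc]
      rfl
    rw [h]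
    exact L.hasFDerivAt.add_const _
  have hL : ‖L‖ ≤ 1 := T.linearIsometryEquiv.toLinearIsometry.norm_toContinuousLinearMap_le
  refine ⟨_, (hT.norm_sq.neg.mul_const (2 * t)⁻¹).exp, ?_⟩
  have hcomp : ‖(innerSL ℝ) (T y - x) ∘SL L‖ ≤ ‖T y - x‖ :=
    (ContinuousLinearMap.opNorm_comp_le _ _).trans <| by
      rw [innerSL_apply_norm]
      exact mul_le_of_le_one_right (norm_nonneg _) hL
  rw [norm_smul, norm_smul, norm_neg, ← Nat.cast_smul_eq_nsmul ℝ, norm_smul,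
    norm_of_nonneg (exp_pos _).le,
    norm_of_nonneg (by positivity : 0 ≤ (2 * t)⁻¹), mul_comm, Pi.neg_apply, ← div_eq_mul_inv]
  gcongr
  calc (2 * t)⁻¹ * (‖((2 : ℕ) : ℝ)‖ * ‖(innerSL ℝ) (T y - x) ∘SL L‖)
      = ‖(innerSL ℝ) (T y - x) ∘SL L‖ / t := by
        simp only [Nat.cast_ofNat, Real.norm_ofNat]; field_simp
    _ ≤ _ := by gcongr

lemma one_add_div_mul_exp_neg_sq_le {s t : ℝ} (ht : 0 < t) :
    (1 + s / t) * exp (-s ^ 2 / (2 * t)) ≤ (5 + 1 / t) * exp (-s ^ 2 / (4 * t)) := by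
  have hexp : exp (-s ^ 2 / (2 * t)) = exp (-s ^ 2 / (4 * t)) * exp (-s ^ 2 / (4 * t)) := by
    rw [← exp_add]; congr 1; field_simp; ring
  have hw : 0 ≤ s ^ 2 / (4 * t) := by positivity
  have h1 : 1 + s / t ≤ (5 + 1 / t) * (s ^ 2 / (4 * t) + 1) := by
    have hs : s / t ≤ 1 / t + 4 * (s ^ 2 / (4 * t)) := by
      rw [show 1 / t + 4 * (s ^ 2 / (4 * t)) = (1 + s ^ 2) / t by field_simp]
      gcongr
      nlinarith [sq_nonneg (s - 1)]
    have : 0 ≤ 1 / t * (s ^ 2 / (4 * t)) := by positivity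
    nlinarith
  have h2 : 1 + s / t ≤ (5 + 1 / t) * exp (s ^ 2 / (4 * t)) :=
    h1.trans (by gcongr; exact add_one_le_exp _)
  calc _ ≤ (5 + 1 / t) * exp (s ^ 2 / (4 * t)) *
        (exp (-s ^ 2 / (4 * t)) * exp (-s ^ 2 / (4 * t))) := by rw [hexp]; gcongr
    _ = _ := by
      rw [neg_div, exp_neg]
      field_simp

variable {D : ℕ}

/-- Locally uniform summable majorant for the Gaussian series and its derivatives. -/
lemma exists_summable_bound_gaussian_cubeUnfold {t : ℝ} (ht : 0 < t)
    (x : EuclideanSpace ℝ (Fin D)) (R : ℝ) :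
    ∃ u : (Fin D → ℤ) → ℝ, Summable u ∧ ∀ z, ∀ y ∈ Metric.ball (0 : EuclideanSpace ℝ (Fin D)) R,
      (1 + ‖cubeUnfold z y - x‖ / t) * exp (-‖cubeUnfold z y - x‖ ^ 2 / (2 * t)) ≤ u z := by
  set K : ℝ := ‖x‖ + 1 + R
  set f : ℤ → ℝ := fun k => exp (K ^ 2 / (4 * t)) * exp (-(1 / (8 * t)) * (k : ℝ) ^ 2) with hf
  have hfs : Summable f := (summable_exp_neg_mul_int_sq (by positivity)).mul_left _
  refine ⟨fun z => (5 + 1 / t) * ∏ i, f (z i),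
    (summable_prod_apply_of_nonneg hfs (fun k => by positivity) D).mul_left _, fun z y hy => ?_⟩
  refine (one_add_div_mul_exp_neg_sq_le ht).trans
    (mul_le_mul_of_nonneg_left ?_ (by positivity))
  have hy : ‖y‖ < R := by simpa using hy
  rw [EuclideanSpace.real_norm_sq_eq, ← Finset.sum_neg_distrib, Finset.sum_div, exp_sum]
  refine Finset.prod_le_prod (fun i _ => (exp_pos _).le) fun i _ => ?_
  simp only [hf]
  rw [← exp_add, exp_le_exp]
  have hyi : |y i| ≤ ‖y‖ := PiLp.norm_apply_le y i
  have hxi : |x i| ≤ ‖x‖ := PiLp.norm_apply_le x i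
  set s : ℝ := (cubeUnfold z y - x) i with hs
  have hc : |(z i : ℝ) - s| ≤ K := by
    have : s = (if Even (z i) then y i else 1 - y i) + (z i : ℝ) - x i := by
      rw [hs, PiLp.sub_apply, cubeUnfold_apply]
    rw [this]
    have := abs_le.1 hyi
    have := abs_le.1 hxi
    rw [abs_le]
    split_ifs <;> constructor <;> linarith
  have hc2 : ((z i : ℝ) - s) ^ 2 ≤ K ^ 2 := sq_le_sq' (abs_le.1 hc).1 (abs_le.1 hc).2
  have : (z i : ℝ) ^ 2 ≤ 2 * s ^ 2 + 2 * K ^ 2 := by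
    nlinarith [sq_nonneg ((z i : ℝ) - 2 * s)]
  have h8 : 0 ≤ (2 * s ^ 2 + 2 * K ^ 2 - (z i : ℝ) ^ 2) / (8 * t) :=
    div_nonneg (by linarith) (by positivity)
  have : K ^ 2 / (4 * t) + -(1 / (8 * t)) * (z i : ℝ) ^ 2 - -s ^ 2 / (4 * t) =
      (2 * s ^ 2 + 2 * K ^ 2 - (z i : ℝ) ^ 2) / (8 * t) := by
    field_simp
    ring
  linarith

lemma qkerE_eq_tsum_cubeUnfold (t : ℝ) (x y : EuclideanSpace ℝ (Fin D)) :
    qkerE D t x y = (2 * π * t) ^ (-(D : ℝ) / 2) *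
      ∑' z : Fin D → ℤ, exp (-‖cubeUnfold z y - x‖ ^ 2 / (2 * t)) := by
  simp only [qkerE, EuclideanSpace.real_norm_sq_eq, PiLp.sub_apply, cubeUnfold_apply]

lemma summable_gaussian_cubeUnfold {t : ℝ} (ht : 0 < t) (x y : EuclideanSpace ℝ (Fin D)) :
    Summable fun z : Fin D → ℤ => exp (-‖cubeUnfold z y - x‖ ^ 2 / (2 * t)) := by
  obtain ⟨u, hu, hle⟩ := exists_summable_bound_gaussian_cubeUnfold ht x (‖y‖ + 1)
  refine .of_nonneg_of_le (fun z => (exp_pos _).le) (fun z => ?_) hu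
  refine le_trans ?_ (hle z y (by simp))
  exact le_mul_of_one_le_left (exp_pos _).le (le_add_of_nonneg_right (by positivity))

lemma qkerE_pos {t : ℝ} (ht : 0 < t) (x y : EuclideanSpace ℝ (Fin D)) : 0 < qkerE D t x y := by
  rw [qkerE_eq_tsum_cubeUnfold]
  exact mul_pos (by positivity) ((summable_gaussian_cubeUnfold ht x y).tsum_pos
    (fun z => (exp_pos _).le) 0 (exp_pos _))

/-- The kernel is differentiable, and its derivative is bounded by the series of the bounds of
the derivatives of its terms. -/
lemma exists_hasFDerivAt_qkerE {t : ℝ} (ht : 0 < t) (x y : EuclideanSpace ℝ (Fin D)) :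
    ∃ q' : EuclideanSpace ℝ (Fin D) →L[ℝ] ℝ, HasFDerivAt (fun y' => qkerE D t x y') q' y ∧
      ‖q'‖ₑ ≤ ∑' z : Fin D → ℤ, ENNReal.ofReal ((2 * π * t) ^ (-(D : ℝ) / 2) *
        (‖cubeUnfold z y - x‖ / t * exp (-‖cubeUnfold z y - x‖ ^ 2 / (2 * t)))) := by
  obtain ⟨u, hu, hle⟩ := exists_summable_bound_gaussian_cubeUnfold ht x (‖y‖ + 1)
  have hy : y ∈ Metric.ball (0 : EuclideanSpace ℝ (Fin D)) (‖y‖ + 1) := by simp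
  choose f' hf' hnorm using fun (z : Fin D → ℤ) (y : EuclideanSpace ℝ (Fin D)) =>
    exists_hasFDerivAt_gaussian_comp (cubeUnfold z) x y ht
  have hbound (z : Fin D → ℤ) : ∀ y' ∈ Metric.ball (0 : EuclideanSpace ℝ (Fin D)) (‖y‖ + 1),
      ‖f' z y'‖ ≤ u z := fun y' hy' => by
    refine (hnorm z y').trans (le_trans ?_ (hle z y' hy'))
    gcongr
    linarith
  have hsum := hasFDerivAt_tsum_of_isPreconnected hu Metric.isOpen_ball
    (convex_ball _ _).isPreconnected (fun z y' _ => hf' z y') hbound hy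
    (summable_gaussian_cubeUnfold ht x y) hy
  refine ⟨_, (hsum.const_mul ((2 * π * t) ^ (-(D : ℝ) / 2))).congr_of_eventuallyEq
    (.of_forall fun y' => qkerE_eq_tsum_cubeUnfold t x y'), ?_⟩
  have hC : 0 ≤ (2 * π * t) ^ (-(D : ℝ) / 2) := by positivity
  rw [enorm_smul, Real.enorm_of_nonneg hC]
  simp_rw [ENNReal.ofReal_mul hC]
  rw [ENNReal.tsum_mul_left]
  gcongr
  refine (enorm_tsum_le_tsum_enorm (f := fun z => f' z y)).trans ?_
  gcongr with z
  rw [← ofReal_norm]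
  exact ENNReal.ofReal_le_ofReal (hnorm z y)

end Kernel

theorem integral_norm_gradient_qker_le (D : ℕ) (hD : 0 < D) (t : ℝ) (ht : 0 < t)
    (x : EuclideanSpace ℝ (Fin D)) (hx : ∀ i, x i ∈ Set.Icc (0 : ℝ) 1) :
    (∫ y in {y : EuclideanSpace ℝ (Fin D) | ∀ i, y i ∈ Set.Icc (0 : ℝ) 1},
        ‖gradient (fun y' => qkerE D t x y') y‖) ≤ Real.sqrt D / Real.sqrt t ∧
    (∫ y in {y : EuclideanSpace ℝ (Fin D) | ∀ i, y i ∈ Set.Icc (0 : ℝ) 1},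
        ‖gradient (fun y' => Real.log (qkerE D t x y')) y‖ * qkerE D t x y) ≤
      Real.sqrt D / Real.sqrt t := by
  have : Nonempty (Fin D) := ⟨⟨0, hD⟩⟩
  have hgrad (g : EuclideanSpace ℝ (Fin D) → ℝ) (y : EuclideanSpace ℝ (Fin D)) :
      ‖gradient g y‖ = ‖fderiv ℝ g y‖ := by simp [gradient]
  have hfirst : (∫ y in {y : EuclideanSpace ℝ (Fin D) | ∀ i, y i ∈ Set.Icc (0 : ℝ) 1},
      ‖gradient (fun y' => qkerE D t x y') y‖) ≤ √D / √t := by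
    have hB : 0 ≤ √D / √t := by positivity
    refine (le_norm_self _).trans <| (norm_integral_le_lintegral_norm _).trans <|
      ENNReal.toReal_le_of_le_ofReal hB ?_
    set G : EuclideanSpace ℝ (Fin D) → ENNReal := fun v =>
      ENNReal.ofReal ((2 * π * t) ^ (-(D : ℝ) / 2) * (‖v‖ / t * exp (-‖v‖ ^ 2 / (2 * t))))
    have hGm : Measurable G := by fun_prop
    calc _ ≤ ∫⁻ y in {y : EuclideanSpace ℝ (Fin D) | ∀ i, y i ∈ Set.Icc (0 : ℝ) 1},
          ∑' z : Fin D → ℤ, G (cubeUnfold z y - x) := by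
          gcongr with y
          obtain ⟨q', hq', hle⟩ := exists_hasFDerivAt_qkerE ht x y
          rw [norm_norm, hgrad, hq'.fderiv, ofReal_norm]
          exact hle
      _ = ∑' z : Fin D → ℤ, ∫⁻ y in {y : EuclideanSpace ℝ (Fin D) | ∀ i, y i ∈ Set.Icc (0 : ℝ) 1},
          G (cubeUnfold z y - x) := lintegral_tsum fun z =>
            (hGm.comp ((cubeUnfold z).continuous.measurable.sub_const x)).aemeasurable
      _ ≤ ∫⁻ u, G (u - x) := tsum_setLIntegral_comp_cubeUnfold_le fun u => G (u - x)
      _ = ∫⁻ v, G v := lintegral_sub_right_eq_self G x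
      _ ≤ ENNReal.ofReal (√D / √t) := by
          simpa using lintegral_norm_div_mul_gaussian_le (E := EuclideanSpace ℝ (Fin D)) ht
  refine ⟨hfirst, le_of_eq_of_le (integral_congr_ae (.of_forall fun y => ?_)) hfirst⟩
  obtain ⟨q', hq', -⟩ := exists_hasFDerivAt_qkerE ht x y
  have hpos := qkerE_pos ht x y
  simp only [hgrad]
  rw [hq'.fderiv, (hq'.log hpos.ne').fderiv, norm_smul, norm_inv, norm_of_nonneg hpos.le]
  field_simp
end

section
/- Let q_t be the reflected heat kernel on [0,1]^D. For all t ∈ (0,1] and x, y ∈ [0,1]^D, |∇_x log q_t(y, x)| ≤ C(√2·|x − y|/t + 1/√t) for a constant C depending only on D. -/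
open MeasureTheory Real

/-- The displacement `R_z(b) + z - a` between `a` and the `z`-th reflected image of `b`. -/
noncomputable def imageDisp {D : ℕ} (a b : EuclideanSpace ℝ (Fin D)) (z : Fin D → ℤ) :
    EuclideanSpace ℝ (Fin D) :=
  WithLp.toLp 2 fun i => (if Even (z i) then b i else 1 - b i) + (z i : ℝ) - a i

theorem qkerE_eq_tsum_imageDisp (D : ℕ) (t : ℝ) (a b : EuclideanSpace ℝ (Fin D)) :
    qkerE D t a b = (2 * π * t) ^ (-(D : ℝ) / 2) *
      ∑' z : Fin D → ℤ, Real.exp (-‖imageDisp a b z‖ ^ 2 / (2 * t)) := by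
  simp only [qkerE, EuclideanSpace.real_norm_sq_eq, imageDisp]

theorem imageDisp_zero {D : ℕ} (a b : EuclideanSpace ℝ (Fin D)) :
    imageDisp a b 0 = b - a := by
  ext i
  simp [imageDisp]

theorem norm_imageDisp_add_sub {D : ℕ} (a b h : EuclideanSpace ℝ (Fin D)) (z : Fin D → ℤ) :
    ‖imageDisp a (b + h) z - imageDisp a b z‖ = ‖h‖ := by
  rw [EuclideanSpace.norm_eq, EuclideanSpace.norm_eq]
  congr 1
  refine Finset.sum_congr rfl fun i _ => ?_
  by_cases hz : Even (z i) <;> simp [imageDisp, hz]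

theorem abs_imageDisp_sub_le {D : ℕ} (a b : EuclideanSpace ℝ (Fin D)) (z : Fin D → ℤ) (i : Fin D) :
    |imageDisp a b z i - z i| ≤ 1 + ‖b‖ + ‖a‖ := by
  have hb := abs_le.1 (PiLp.norm_apply_le b i)
  have ha := abs_le.1 (PiLp.norm_apply_le a i)
  by_cases hz : Even (z i) <;> simp only [imageDisp, hz, if_true, if_false, abs_le] <;>
    constructor <;> linarith

theorem abs_imageDisp_sub_le_one {D : ℕ} {a b : EuclideanSpace ℝ (Fin D)}
    (ha : ∀ i, a i ∈ Set.Icc (0 : ℝ) 1) (hb : ∀ i, b i ∈ Set.Icc (0 : ℝ) 1)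
    (z : Fin D → ℤ) (i : Fin D) :
    |imageDisp a b z i - z i| ≤ 1 := by
  obtain ⟨ha₀, ha₁⟩ := ha i
  obtain ⟨hb₀, hb₁⟩ := hb i
  by_cases hz : Even (z i) <;> simp only [imageDisp, hz, if_true, if_false, abs_le] <;>
    constructor <;> linarith

theorem summable_int_exp_neg_mul_sq {c : ℝ} (hc : 0 < c) :
    Summable fun n : ℤ => Real.exp (-c * (n : ℝ) ^ 2) := by
  have hnat : Summable fun n : ℕ => Real.exp (-c * (n : ℝ) ^ 2) := by
    refine Summable.of_nonneg_of_le (fun n => (Real.exp_pos _).le) (fun n => ?_)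
      (summable_geometric_of_lt_one (Real.exp_pos (-c)).le (by simpa using hc))
    rw [← Real.exp_nat_mul]
    have hn : (n : ℝ) ≤ (n : ℝ) ^ 2 := by exact_mod_cast Nat.le_self_pow two_ne_zero n
    exact Real.exp_le_exp.2 (by nlinarith)
  exact Summable.of_nat_of_neg (by simpa using hnat) (by simpa using hnat)

/-- Gaussian sums over a bounded perturbation of the lattice `ℤ^D` converge, with a bound
depending only on the size of the perturbation. -/
theorem exists_gaussian_lattice_bound (D : ℕ) {c : ℝ} (hc : 0 < c) (M : ℝ) :
    ∃ K : ℝ, ∀ u : (Fin D → ℤ) → EuclideanSpace ℝ (Fin D), (∀ z i, |u z i - z i| ≤ M) →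
      Summable (fun z => Real.exp (-c * ‖u z‖ ^ 2)) ∧
        ∑' z, Real.exp (-c * ‖u z‖ ^ 2) ≤ K := by
  set g : ℤ → ℝ := fun n => Real.exp (c * M ^ 2) * Real.exp (-(c / 2) * (n : ℝ) ^ 2) with hg
  have hg₀ : ∀ n, 0 ≤ g n := fun n => by positivity
  have hgs : Summable g := (summable_int_exp_neg_mul_sq (half_pos hc)).mul_left _
  refine ⟨(∑' n, g n) ^ D, fun u hu => ?_⟩
  have hle : ∀ z, Real.exp (-c * ‖u z‖ ^ 2) ≤ ∏ i, g (z i) := fun z => by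
    rw [EuclideanSpace.real_norm_sq_eq, Finset.mul_sum, Real.exp_sum]
    refine Finset.prod_le_prod (fun i _ => (Real.exp_pos _).le) fun i _ => ?_
    simp only [hg, ← Real.exp_add]
    refine Real.exp_le_exp.2 ?_
    have hM : (u z i - z i) ^ 2 ≤ M ^ 2 := sq_le_sq' (abs_le.1 (hu z i)).1 (abs_le.1 (hu z i)).2
    nlinarith [sq_nonneg (2 * u z i - z i)]
  have hfin : ∀ s : Finset (Fin D → ℤ), ∑ z ∈ s, Real.exp (-c * ‖u z‖ ^ 2) ≤ (∑' n, g n) ^ D := by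
    intro s
    have hsub : s ⊆ Fintype.piFinset fun i => s.image fun z => z i := fun z hz =>
      Fintype.mem_piFinset.2 fun i => Finset.mem_image_of_mem (fun z : Fin D → ℤ => z i) hz
    calc ∑ z ∈ s, Real.exp (-c * ‖u z‖ ^ 2)
        ≤ ∑ z ∈ s, ∏ i, g (z i) := Finset.sum_le_sum fun z _ => hle z
      _ ≤ ∑ z ∈ Fintype.piFinset fun i => s.image fun z => z i, ∏ i, g (z i) :=
          Finset.sum_le_sum_of_subset_of_nonneg hsub fun z _ _ =>
            Finset.prod_nonneg fun i _ => hg₀ _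
      _ = ∏ i : Fin D, ∑ n ∈ s.image fun z => z i, g n := (Finset.prod_univ_sum _ _).symm
      _ ≤ ∏ _i : Fin D, ∑' n, g n :=
          Finset.prod_le_prod (fun i _ => Finset.sum_nonneg fun n _ => hg₀ n)
            fun i _ => hgs.sum_le_tsum _ fun n _ => hg₀ n
      _ = (∑' n, g n) ^ D := by simp
  have hs := summable_of_sum_le (fun z => (Real.exp_pos _).le) hfin
  exact ⟨hs, hs.tsum_le_of_sum_le hfin⟩

theorem summable_exp_imageDisp {D : ℕ} {t : ℝ} (ht : 0 < t) (a b : EuclideanSpace ℝ (Fin D)) :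
    Summable fun z => Real.exp (-‖imageDisp a b z‖ ^ 2 / (2 * t)) := by
  obtain ⟨K, hK⟩ := exists_gaussian_lattice_bound D (c := 1 / (2 * t)) (by positivity)
    (1 + ‖b‖ + ‖a‖)
  refine (hK (imageDisp a b) (abs_imageDisp_sub_le a b)).1.congr fun z => ?_
  congr 1
  ring

/-- A one-sided local Lipschitz bound controls the norm of the gradient. -/
theorem norm_gradient_le_of_eventually_sub_le {E : Type*} [NormedAddCommGroup E]
    [InnerProductSpace ℝ E] [CompleteSpace E] {f : E → ℝ} {x : E} {L : ℝ} (hL : 0 ≤ L)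
    (hf : ∀ᶠ h in nhds (0 : E), f (x + h) - f x ≤ L * ‖h‖) :
    ‖gradient f x‖ ≤ L := by
  by_cases hd : DifferentiableAt ℝ f x
  · set g := gradient f x
    have hline : HasLineDerivAt ℝ f (inner ℝ g g) x g := by
      exact hd.hasGradientAt.hasFDerivAt.hasLineDerivAt g
    have hev : ∀ᶠ s : ℝ in nhdsWithin 0 (Set.Ioi 0), s⁻¹ • (f (x + s • g) - f x) ≤ L * ‖g‖ := by
      have htend : Filter.Tendsto (fun s : ℝ => s • g) (nhdsWithin 0 (Set.Ioi 0)) (nhds 0) := by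
        have : Filter.Tendsto (fun s : ℝ => s • g) (nhds 0) (nhds ((0 : ℝ) • g)) :=
          (continuous_id.smul continuous_const).tendsto 0
        rw [zero_smul] at this
        exact this.mono_left nhdsWithin_le_nhds
      filter_upwards [htend.eventually hf, self_mem_nhdsWithin] with s hs hs₀
      have hs₀ : 0 < s := hs₀
      rw [norm_smul, Real.norm_of_nonneg hs₀.le] at hs
      rw [smul_eq_mul, inv_mul_le_iff₀ hs₀]
      linarith
    have hle := le_of_tendsto hline.tendsto_slope_zero_right hev
    rw [real_inner_self_eq_norm_sq] at hle
    by_contra! hlt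
    nlinarith
  · simpa [gradient, fderiv_zero_of_not_differentiableAt hd] using hL

theorem norm_sq_sub_norm_add_sq_le {E : Type*} [NormedAddCommGroup E] [InnerProductSpace ℝ E]
    (u k : E) : ‖u‖ ^ 2 - ‖u + k‖ ^ 2 ≤ 2 * (‖u‖ * ‖k‖) := by
  rw [norm_add_sq_real]
  nlinarith [neg_le_of_abs_le (abs_real_inner_le_norm u k), sq_nonneg ‖k‖]

theorem exp_sub_exp_gaussian_le {E : Type*} [NormedAddCommGroup E] [InnerProductSpace ℝ E]
    {t : ℝ} (ht : 0 < t) (u k : E) :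
    Real.exp (-‖u + k‖ ^ 2 / (2 * t)) - Real.exp (-‖u‖ ^ 2 / (2 * t)) ≤
      ‖k‖ * (‖u‖ / t * Real.exp (-‖u‖ ^ 2 / (2 * t) + ‖u‖ * ‖k‖ / t)) := by
  set A := -‖u + k‖ ^ 2 / (2 * t)
  set B := -‖u‖ ^ 2 / (2 * t)
  have hAB : A - B ≤ ‖u‖ * ‖k‖ / t := by
    have : A - B = (‖u‖ ^ 2 - ‖u + k‖ ^ 2) / (2 * t) := by simp only [A, B]; ring
    rw [this, div_le_div_iff₀ (by positivity) ht]
    nlinarith [norm_sq_sub_norm_add_sq_le u k]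
  have hfac : Real.exp B = Real.exp A * Real.exp (-(A - B)) := by
    rw [← Real.exp_add]; ring_nf
  calc Real.exp A - Real.exp B ≤ (A - B) * Real.exp A := by
        nlinarith [Real.add_one_le_exp (-(A - B)), Real.exp_pos A]
    _ ≤ ‖u‖ * ‖k‖ / t * Real.exp (B + ‖u‖ * ‖k‖ / t) := by
        gcongr
        linarith
    _ = _ := by ring

/-- Local bound on the increment of one Gaussian term in terms of the reference distance `r`:
either the image is at distance at most `√2 r`, or it decays relative to the reference term. -/
theorem exp_sub_exp_gaussian_le_ref {E : Type*} [NormedAddCommGroup E] [InnerProductSpace ℝ E]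
    {t r : ℝ} (ht : 0 < t) (ht₁ : t ≤ 1) (hr : 0 ≤ r) (u k : E)
    (hk : √2 * r * ‖k‖ ≤ t) (hk₂ : 2 * ‖k‖ ^ 2 ≤ t) :
    Real.exp (-‖u + k‖ ^ 2 / (2 * t)) - Real.exp (-‖u‖ ^ 2 / (2 * t)) ≤
      ‖k‖ * (Real.exp 1 * (√2 * r / t) * Real.exp (-‖u‖ ^ 2 / (2 * t)) +
        4 * Real.exp 1 * (1 / √t) * Real.exp (-r ^ 2 / (2 * t)) *
          Real.exp (-(1 / 16) * ‖u‖ ^ 2)) := by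
  refine (exp_sub_exp_gaussian_le ht u k).trans (mul_le_mul_of_nonneg_left ?_ (norm_nonneg k))
  by_cases hu : ‖u‖ ≤ √2 * r
  · refine le_add_of_le_of_nonneg ?_ (by positivity)
    have hexp : ‖u‖ * ‖k‖ / t ≤ 1 := by
      rw [div_le_one ht]
      exact (mul_le_mul_of_nonneg_right hu (norm_nonneg k)).trans hk
    calc ‖u‖ / t * Real.exp (-‖u‖ ^ 2 / (2 * t) + ‖u‖ * ‖k‖ / t)
        ≤ √2 * r / t * Real.exp (-‖u‖ ^ 2 / (2 * t) + 1) := by gcongr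
      _ = _ := by rw [Real.exp_add]; ring
  · refine le_add_of_nonneg_of_le (by positivity) ?_
    have hu2 : 2 * r ^ 2 ≤ ‖u‖ ^ 2 := by
      have := pow_le_pow_left₀ (by positivity) (not_le.1 hu).le 2
      rwa [mul_pow, Real.sq_sqrt zero_le_two] at this
    have hexp : -‖u‖ ^ 2 / (2 * t) + ‖u‖ * ‖k‖ / t ≤
        1 + -r ^ 2 / (2 * t) + -(‖u‖ ^ 2 / (16 * t)) + -(‖u‖ ^ 2 / (16 * t)) := by
      have : 1 + -r ^ 2 / (2 * t) + -(‖u‖ ^ 2 / (16 * t)) + -(‖u‖ ^ 2 / (16 * t)) -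
          (-‖u‖ ^ 2 / (2 * t) + ‖u‖ * ‖k‖ / t) =
          (8 * t + 3 * ‖u‖ ^ 2 - 4 * r ^ 2 - 8 * (‖u‖ * ‖k‖)) / (8 * t) := by
        field_simp
        ring
      rw [← sub_nonneg, this]
      refine div_nonneg ?_ (by positivity)
      nlinarith [sq_nonneg (‖u‖ - 4 * ‖k‖)]
    have hpoly : ‖u‖ / t * Real.exp (-(‖u‖ ^ 2 / (16 * t))) ≤ 4 * (1 / √t) := by
      set s := ‖u‖ / √t with hs
      have hst : ‖u‖ / t = s * (1 / √t) := by
        rw [hs, div_mul_div_comm, Real.mul_self_sqrt ht.le, mul_one]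
      have hss : ‖u‖ ^ 2 / (16 * t) = s ^ 2 / 16 := by
        rw [hs, div_pow, Real.sq_sqrt ht.le]; field_simp
      have hs4 : s * Real.exp (-(s ^ 2 / 16)) ≤ 4 := by
        rw [Real.exp_neg, ← div_eq_mul_inv, div_le_iff₀ (Real.exp_pos _)]
        nlinarith [Real.add_one_le_exp (s ^ 2 / 16), sq_nonneg (s - 2)]
      rw [hst, hss, mul_right_comm]
      exact mul_le_mul_of_nonneg_right hs4 (by positivity)
    have hlast : -(‖u‖ ^ 2 / (16 * t)) ≤ -(1 / 16) * ‖u‖ ^ 2 := by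
      have : ‖u‖ ^ 2 / 16 ≤ ‖u‖ ^ 2 / (16 * t) :=
        div_le_div_of_nonneg_left (sq_nonneg _) (by positivity) (by linarith)
      linarith
    calc ‖u‖ / t * Real.exp (-‖u‖ ^ 2 / (2 * t) + ‖u‖ * ‖k‖ / t)
        ≤ ‖u‖ / t * Real.exp (1 + -r ^ 2 / (2 * t) + -(‖u‖ ^ 2 / (16 * t)) +
            -(‖u‖ ^ 2 / (16 * t))) := by gcongr
      _ = (‖u‖ / t * Real.exp (-(‖u‖ ^ 2 / (16 * t)))) * (Real.exp 1 *
            Real.exp (-r ^ 2 / (2 * t)) * Real.exp (-(‖u‖ ^ 2 / (16 * t)))) := by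
          simp only [Real.exp_add]; ring
      _ ≤ (4 * (1 / √t)) * (Real.exp 1 * Real.exp (-r ^ 2 / (2 * t)) *
            Real.exp (-(1 / 16) * ‖u‖ ^ 2)) := by gcongr
      _ = _ := by ring

theorem gradient_log_qker_bound (D : ℕ) (hD : 0 < D) :
    ∃ C > 0, ∀ t : ℝ, 0 < t → t ≤ 1 →
      ∀ x y : EuclideanSpace ℝ (Fin D),
        (∀ i, x i ∈ Set.Icc (0 : ℝ) 1) → (∀ i, y i ∈ Set.Icc (0 : ℝ) 1) →
        ‖gradient (fun x' => Real.log (qkerE D t y x')) x‖ ≤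
          C * (Real.sqrt 2 * ‖x - y‖ / t + 1 / Real.sqrt t) := by
  obtain ⟨K, hK⟩ := exists_gaussian_lattice_bound D (c := 1 / 16) (by norm_num) 1
  refine ⟨Real.exp 1 * (1 + 4 * |K|), by positivity, fun t ht ht₁ x y hx hy => ?_⟩
  obtain ⟨hsum, hbound⟩ := hK (imageDisp y x) (abs_imageDisp_sub_le_one hy hx)
  set r := ‖x - y‖
  set S : EuclideanSpace ℝ (Fin D) → ℝ :=
    fun b => ∑' z, Real.exp (-‖imageDisp y b z‖ ^ 2 / (2 * t))
  have href : ∀ b, Real.exp (-‖b - y‖ ^ 2 / (2 * t)) ≤ S b := fun b => by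
    rw [← imageDisp_zero]
    exact (summable_exp_imageDisp ht y b).le_tsum 0 fun z _ => (Real.exp_pos _).le
  have hS : ∀ b, 0 < S b := fun b => (Real.exp_pos _).trans_le (href b)
  refine norm_gradient_le_of_eventually_sub_le (by positivity) ?_
  have hsmall : ∀ᶠ h in nhds (0 : EuclideanSpace ℝ (Fin D)), √2 * r * ‖h‖ < t ∧ 2 * ‖h‖ ^ 2 < t :=
    (Continuous.tendsto' (by fun_prop) 0 0 (by simp) |>.eventually_lt_const ht).and
      (Continuous.tendsto' (by fun_prop) 0 0 (by simp) |>.eventually_lt_const ht)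
  filter_upwards [hsmall] with h ⟨hh, hh₂⟩
  have hterm : ∀ z, Real.exp (-‖imageDisp y (x + h) z‖ ^ 2 / (2 * t)) ≤
      Real.exp (-‖imageDisp y x z‖ ^ 2 / (2 * t)) +
      ‖h‖ * (Real.exp 1 * (√2 * r / t) * Real.exp (-‖imageDisp y x z‖ ^ 2 / (2 * t)) +
        4 * Real.exp 1 * (1 / √t) * Real.exp (-r ^ 2 / (2 * t)) *
          Real.exp (-(1 / 16) * ‖imageDisp y x z‖ ^ 2)) := fun z => by
    have hk := norm_imageDisp_add_sub y x h z
    have := exp_sub_exp_gaussian_le_ref ht ht₁ (norm_nonneg (x - y)) (imageDisp y x z)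
      (imageDisp y (x + h) z - imageDisp y x z) (by rw [hk]; exact hh.le) (by rw [hk]; exact hh₂.le)
    rw [add_sub_cancel, hk] at this
    linarith
  have hs := summable_exp_imageDisp ht y x
  have hinc : S (x + h) ≤ S x + ‖h‖ * (Real.exp 1 * (√2 * r / t) * S x +
      4 * Real.exp 1 * (1 / √t) * Real.exp (-r ^ 2 / (2 * t)) *
        ∑' z, Real.exp (-(1 / 16) * ‖imageDisp y x z‖ ^ 2)) := by
    have hhs := hs.hasSum.add (((hs.hasSum.mul_left (Real.exp 1 * (√2 * r / t))).add
      (hsum.hasSum.mul_left (4 * Real.exp 1 * (1 / √t) * Real.exp (-r ^ 2 / (2 * t))))).mul_left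
        ‖h‖)
    exact hasSum_le hterm (summable_exp_imageDisp ht y (x + h)).hasSum hhs
  have hratio : S (x + h) ≤
      S x * (1 + Real.exp 1 * (1 + 4 * |K|) * (√2 * r / t + 1 / √t) * ‖h‖) := by
    have htail : 4 * Real.exp 1 * (1 / √t) * Real.exp (-r ^ 2 / (2 * t)) *
        ∑' z, Real.exp (-(1 / 16) * ‖imageDisp y x z‖ ^ 2) ≤
        4 * Real.exp 1 * (1 / √t) * S x * |K| := by
      gcongr
      · exact href x
      · exact hbound.trans (le_abs_self K)
    have hslack : 0 ≤ S x * ‖h‖ * Real.exp 1 * (1 / √t + 4 * |K| * (√2 * r / t)) := by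
      have := (hS x).le
      positivity
    nlinarith [mul_le_mul_of_nonneg_left htail (norm_nonneg h)]
  have hpre : (2 * π * t) ^ (-(D : ℝ) / 2) ≠ 0 := by positivity
  simp only [qkerE_eq_tsum_imageDisp]
  change Real.log (_ * S (x + h)) - Real.log (_ * S x) ≤ _
  rw [Real.log_mul hpre (hS _).ne', Real.log_mul hpre (hS _).ne', add_sub_add_left_eq_sub,
    ← Real.log_div (hS _).ne' (hS _).ne']
  have hlog := Real.log_le_sub_one_of_pos (div_pos (hS (x + h)) (hS x))
  have hdiv := (div_le_iff₀' (hS x)).2 hratio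
  linarith
end
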